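/- Let g(T) ∈ K[T] be monic, irreducible, and separable, and let L ⊇ K be a finite separable extension with h(T) ∈ L[T] monic. If h(T) divides g(T) in L[T] and deg g(T) = [L:K] · deg h(T), then g(T) = Nm_{L|K} h(T). -/

import Mathlib

open Polynomial

/-- Let `g(T) ∈ K[T]` be monic, irreducible, and separable, and let `L ⊇ K`
be a finite separable extension with `h(T) ∈ L[T]` monic. If `h(T)` divides `g(T)` in
`L[T]` and `deg g(T) = [L:K] · deg h(T)`, then `g(T) = Nm_{L|K} h(T)`. -/
theorem norm_eq_of_dvd_of_degree_eq
    (K L : Type*) [Field K] [Field L] [Algebra K L]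
    [FiniteDimensional K L] [Algebra.IsSeparable K L]
    (g : Polynomial K) (hmonic : g.Monic) (hirr : Irreducible g) (hsep : g.Separable)
    (h : Polynomial L) (hhm : h.Monic)
    (hdvd : h ∣ g.map (algebraMap K L))
    (hdeg : g.natDegree = Module.finrank K L * h.natDegree) :
    g.map (algebraMap K (SeparableClosure K)) =
      ∏ v : L →ₐ[K] SeparableClosure K, h.map v.toRingHom := by
  classical
  set Ω := SeparableClosure K with hΩ
  have hcard : Fintype.card (L →ₐ[K] Ω) = Module.finrank K L :=
    AlgHom.card_of_splits K L Ω fun x =>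
      IsSepClosed.splits_codomain _ (Algebra.IsSeparable.isSeparable K x)
  have hGm : (g.map (algebraMap K Ω)).Monic := hmonic.map _
  have hGs : (g.map (algebraMap K Ω)).Splits := IsSepClosed.splits_codomain _ hsep
  have hPm : (∏ v : L →ₐ[K] Ω, h.map v.toRingHom).Monic :=
    monic_prod_of_monic _ _ fun v _ => hhm.map _
  have hPd : (∏ v : L →ₐ[K] Ω, h.map v.toRingHom).natDegree =
      (g.map (algebraMap K Ω)).natDegree := by
    rw [natDegree_prod_of_monic _ _ fun v _ => hhm.map _, natDegree_map, hdeg, ← hcard]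
    simp
  have hh0 : h.natDegree ≠ 0 := by
    intro h0
    have := hirr.natDegree_pos
    rw [hdeg, h0] at this
    simp at this
  have hvdvd : ∀ v : L →ₐ[K] Ω, h.map v.toRingHom ∣ g.map (algebraMap K Ω) := by
    intro v
    have := Polynomial.map_dvd v.toRingHom hdvd
    rw [Polynomial.map_map] at this
    have e : v.toRingHom.comp (algebraMap K L) = algebraMap K Ω := v.comp_algebraMap
    rwa [e] at this
  have hpos : 0 < Fintype.card (L →ₐ[K] Ω) := hcard ▸ Module.finrank_pos
  obtain ⟨v₀⟩ := Fintype.card_pos_iff.mp hpos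
  obtain ⟨α, hα⟩ := (hGs.of_dvd hGm.ne_zero (hvdvd v₀)).exists_eval_eq_zero
    (degree_ne_of_natDegree_ne (by rwa [natDegree_map]))
  have hαg : (g.map (algebraMap K Ω)).eval α = 0 :=
    eval_eq_zero_of_dvd_of_eval_eq_zero (hvdvd v₀) hα
  have hmin : ∀ x : Ω, (g.map (algebraMap K Ω)).eval x = 0 → g = minpoly K x := by
    intro x hx
    rw [eval_map_algebraMap] at hx
    exact minpoly.eq_of_irreducible_of_monic hirr hx hmonic
  have hdv : g.map (algebraMap K Ω) ∣ ∏ v : L →ₐ[K] Ω, h.map v.toRingHom := by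
    rw [Splits.dvd_iff_roots_le_roots hGs hGm.ne_zero hPm.ne_zero,
      Multiset.le_iff_subset (nodup_roots hsep.map)]
    intro β hβ
    rw [mem_roots hGm.ne_zero, IsRoot.def] at hβ
    rw [mem_roots hPm.ne_zero, IsRoot.def, eval_prod]
    obtain ⟨σ, hσ⟩ := (Normal.minpoly_eq_iff_mem_orbit Ω).mp ((hmin β hβ).symm.trans (hmin α hαg))
    refine Finset.prod_eq_zero (Finset.mem_univ ((σ : Ω →ₐ[K] Ω).comp v₀)) ?_
    have e : ((σ : Ω →ₐ[K] Ω).comp v₀).toRingHom = (σ : Ω →ₐ[K] Ω).toRingHom.comp v₀.toRingHom := rfl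
    have hσ' : (σ : Ω →ₐ[K] Ω).toRingHom α = β := hσ
    rw [e, ← Polynomial.map_map, ← hσ', eval_map_apply, hα, map_zero]
  exact (eq_of_monic_of_dvd_of_natDegree_le hGm hPm hdv hPd.le).symm
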